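/- For every positive integer N there exists a finite simple connected graph G such that the universal Gröbner basis of the toric ideal I_G contains a binomial whose degree exceeds the degree of every circuit of I_G by at least N. -/

import Mathlib

open MvPolynomial

noncomputable section

/-! ### Term orders, initial terms, (reduced) Gröbner bases, universal Gröbner basis -/

/-- A term order on the monomials (exponent vectors) in variables indexed by `σ`:
a linear order for which `0` is least and which is compatible with addition. -/
structure TermOrder (σ : Type*) where
  lo : LinearOrder (σ →₀ ℕ)
  zero_min : ∀ u : σ →₀ ℕ, lo.le 0 u
  add_right : ∀ u v w : σ →₀ ℕ, lo.le u v → lo.le (u + w) (v + w)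

variable {σ : Type*} {K : Type*} [Field K]

/-- The leading (largest) exponent of a polynomial with respect to a term order
(junk value `0` if `f = 0`). -/
def TermOrder.leadExp (t : TermOrder σ) (f : MvPolynomial σ K) : σ →₀ ℕ :=
  haveI := Classical.propDecidable (f = 0)
  if h : f = 0 then 0
  else @Finset.max' _ t.lo f.support
    (Finset.nonempty_iff_ne_empty.mpr fun he => h (MvPolynomial.support_eq_empty.mp he))

/-- The initial term of a polynomial with respect to a term order. -/
def TermOrder.initial (t : TermOrder σ) (f : MvPolynomial σ K) : MvPolynomial σ K :=
  monomial (t.leadExp f) (f.coeff (t.leadExp f))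

/-- `𝒢` is a Gröbner basis of `I` w.r.t. the term order `t`. -/
def IsGroebnerBasis (t : TermOrder σ) (I : Ideal (MvPolynomial σ K))
    (𝒢 : Finset (MvPolynomial σ K)) : Prop :=
  (𝒢 : Set (MvPolynomial σ K)) ⊆ (I : Set (MvPolynomial σ K)) ∧
    Ideal.span (t.initial '' (𝒢 : Set (MvPolynomial σ K))) =
      Ideal.span (t.initial '' (I : Set (MvPolynomial σ K)))

/-- `𝒢` is a reduced Gröbner basis of `I` w.r.t. `t`: a Gröbner basis, all of whose elements
are monic, and no monomial occurring in an element of `𝒢` is divisible by the initial term of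
a different element of `𝒢`. -/
def IsReducedGroebnerBasis (t : TermOrder σ) (I : Ideal (MvPolynomial σ K))
    (𝒢 : Finset (MvPolynomial σ K)) : Prop :=
  IsGroebnerBasis t I 𝒢 ∧
    (∀ g ∈ 𝒢, g.coeff (t.leadExp g) = 1) ∧
    (∀ g ∈ 𝒢, ∀ g' ∈ 𝒢, g' ≠ g → ∀ u ∈ g.support, ¬ t.leadExp g' ≤ u)

/-- The universal Gröbner basis of `I`: the union of all reduced Gröbner bases of `I`
over all term orders. -/
def UniversalGB (I : Ideal (MvPolynomial σ K)) : Set (MvPolynomial σ K) :=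
  {f | ∃ (t : TermOrder σ) (𝒢 : Finset (MvPolynomial σ K)),
    IsReducedGroebnerBasis t I 𝒢 ∧ f ∈ 𝒢}

/-! ### Binomials, primitive binomials (Graver basis), circuits -/

/-- The binomial `x^u - x^v`. -/
def binom (K : Type*) [Field K] {σ : Type*} (u v : σ →₀ ℕ) : MvPolynomial σ K :=
  monomial u 1 - monomial v 1

/-- `f` is a primitive binomial of `I`: `f = x^u - x^v ∈ I` and there is no other binomial
`x^w - x^z ∈ I` with `x^w ∣ x^u` and `x^z ∣ x^v`.  The set of primitive binomials of `I`
is the Graver basis of `I`. -/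
def IsPrimitiveBinomial (I : Ideal (MvPolynomial σ K)) (f : MvPolynomial σ K) : Prop :=
  ∃ u v : σ →₀ ℕ, u ≠ v ∧ f = binom K u v ∧ f ∈ I ∧
    ∀ w z : σ →₀ ℕ, w ≠ z → binom K w z ∈ I → w ≤ u → z ≤ v → w = u ∧ z = v

/-- `f` is a circuit of `I`: an irreducible binomial of `I` whose support (set of variables
occurring in it) is minimal among the supports of nonzero binomials of `I`. -/
def IsCircuitBinomial (I : Ideal (MvPolynomial σ K)) (f : MvPolynomial σ K) : Prop :=
  (∃ u v : σ →₀ ℕ, u ≠ v ∧ f = binom K u v) ∧ f ∈ I ∧ Irreducible f ∧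
    ∀ g : MvPolynomial σ K, (∃ u v : σ →₀ ℕ, u ≠ v ∧ g = binom K u v) → g ∈ I →
      g.vars ⊆ f.vars → g.vars = f.vars

/-- The toric ideal of a vector configuration `A = (a_1, …, a_m) ⊆ ℕ^n`: the ideal generated
by all binomials `x^u - x^v` with `Σ uᵢ aᵢ = Σ vᵢ aᵢ`. -/
def toricIdealOfConfig (K : Type*) [Field K] {m n : ℕ} (A : Fin m → Fin n → ℕ) :
    Ideal (MvPolynomial (Fin m) K) :=
  Ideal.span {f | ∃ u v : Fin m →₀ ℕ,
    f = binom K u v ∧ (∑ i, u i • A i) = ∑ i, v i • A i}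

/-! ### Toric ideals of graphs -/

variable {V : Type*}

/-- The image `x_u * x_v` of an edge `e = {u, v}`. -/
def edgeImage (K : Type*) [Field K] {V : Type*} (e : Sym2 V) : MvPolynomial V K :=
  Sym2.lift ⟨fun a b => X a * X b, fun a b => mul_comm _ _⟩ e

/-- The toric ideal `I_G` of a graph `G`: the kernel of the `K`-algebra map
`K[e : e ∈ E(G)] → K[x_v : v ∈ V(G)]`, `e = {u,v} ↦ x_u x_v`. -/
def graphToricIdeal (K : Type*) [Field K] (G : SimpleGraph V) :
    Ideal (MvPolynomial G.edgeSet K) :=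
  RingHom.ker (MvPolynomial.aeval
    (fun e : G.edgeSet => edgeImage K (e : Sym2 V)) :
      MvPolynomial G.edgeSet K →ₐ[K] MvPolynomial V K).toRingHom

/-- An even closed walk `(v_0, v_1, …, v_{2q} = v_0)` in a graph `G`;
edges and vertices may repeat. -/
structure EvenClosedWalk (G : SimpleGraph V) where
  q : ℕ
  verts : ℕ → V
  adj : ∀ i, i < 2 * q → G.Adj (verts i) (verts (i + 1))
  closed : verts (2 * q) = verts 0

namespace EvenClosedWalk

variable {G : SimpleGraph V}

/-- The `i`-th edge of the walk, as an element of the edge set of `G`. -/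
def edge (w : EvenClosedWalk G) (i : ℕ) (h : i < 2 * w.q) : G.edgeSet :=
  ⟨s(w.verts i, w.verts (i + 1)), w.adj i h⟩

/-- The exponent vector `w⁺` of the monomial `E⁺(w)`, the product of the edges of `w`
in odd position (`1`-indexed). -/
def plusExp (w : EvenClosedWalk G) : G.edgeSet →₀ ℕ :=
  ∑ k : Fin w.q, Finsupp.single (w.edge (2 * (k : ℕ)) (by have := k.isLt; omega)) 1

/-- The exponent vector `w⁻` of the monomial `E⁻(w)`, the product of the edges of `w`
in even position (`1`-indexed). -/
def minusExp (w : EvenClosedWalk G) : G.edgeSet →₀ ℕ :=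
  ∑ k : Fin w.q, Finsupp.single (w.edge (2 * (k : ℕ) + 1) (by have := k.isLt; omega)) 1

end EvenClosedWalk

/-- The monomial `E⁺(w)`. -/
def Eplus (K : Type*) [Field K] {G : SimpleGraph V} (w : EvenClosedWalk G) :
    MvPolynomial G.edgeSet K :=
  monomial w.plusExp 1

/-- The monomial `E⁻(w)`. -/
def Eminus (K : Type*) [Field K] {G : SimpleGraph V} (w : EvenClosedWalk G) :
    MvPolynomial G.edgeSet K :=
  monomial w.minusExp 1

/-- The binomial `B_w = E⁺(w) - E⁻(w)` of an even closed walk. -/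
def Bw (K : Type*) [Field K] {G : SimpleGraph V} (w : EvenClosedWalk G) :
    MvPolynomial G.edgeSet K :=
  binom K w.plusExp w.minusExp

namespace EvenClosedWalk

variable {G : SimpleGraph V}

/-- The number of positions of the walk at which the edge `e` appears. -/
def count [DecidableEq V] (w : EvenClosedWalk G) (e : Sym2 V) : ℕ :=
  ((Finset.range (2 * w.q)).filter fun i => e = s(w.verts i, w.verts (i + 1))).card

/-- The subgraph `𝐰` of `G` spanned by the edges of the walk `w`. -/
def graph (w : EvenClosedWalk G) : SimpleGraph V :=
  SimpleGraph.fromEdgeSet {e | ∃ i, ∃ _ : i < 2 * w.q, e = s(w.verts i, w.verts (i + 1))}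

/-- The set `w⁺` of edges of `w` in odd position (`1`-indexed). -/
def plusEdges (w : EvenClosedWalk G) : Set (Sym2 V) :=
  {e | ∃ k, ∃ _ : k < w.q, e = s(w.verts (2 * k), w.verts (2 * k + 1))}

/-- The set `w⁻` of edges of `w` in even position (`1`-indexed). -/
def minusEdges (w : EvenClosedWalk G) : Set (Sym2 V) :=
  {e | ∃ k, ∃ _ : k < w.q, e = s(w.verts (2 * k + 1), w.verts (2 * k + 2))}

/-- An even closed walk is primitive if it is nontrivial and there is no even closed
subwalk `ξ` of smaller length with `E⁺(ξ) ∣ E⁺(w)` and `E⁻(ξ) ∣ E⁻(w)`. -/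
def IsPrimitive (w : EvenClosedWalk G) : Prop :=
  0 < w.q ∧ ∀ ξ : EvenClosedWalk G, 0 < ξ.q → ξ.q < w.q →
    ¬(ξ.plusExp ≤ w.plusExp ∧ ξ.minusExp ≤ w.minusExp)

/-- The walk `w` is a cycle: it visits no vertex twice. -/
def IsCycle (w : EvenClosedWalk G) : Prop :=
  2 ≤ w.q ∧ ∀ i j, i < 2 * w.q → j < 2 * w.q → w.verts i = w.verts j → i = j

end EvenClosedWalk

/-! ### Cut vertices, cut edges, blocks, sinks -/

/-- `v` is a cut vertex of `H`: removing `v` (and the edges through it) disconnects two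
vertices different from `v` that were connected in `H`. -/
def IsCutVertex (H : SimpleGraph V) (v : V) : Prop :=
  ∃ a b, a ≠ v ∧ b ≠ v ∧ H.Reachable a b ∧
    ¬(SimpleGraph.fromEdgeSet {e | e ∈ H.edgeSet ∧ v ∉ e}).Reachable a b

/-- `e` is a cut edge of `H`: removing it disconnects two vertices connected in `H`. -/
def IsCutEdge (H : SimpleGraph V) (e : Sym2 V) : Prop :=
  e ∈ H.edgeSet ∧ ∃ a b, H.Reachable a b ∧ ¬(H.deleteEdges {e}).Reachable a b

/-- `H` is biconnected: it has an edge, it is connected (on its support),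
and it has no cut vertex. -/
def IsBiconnected (H : SimpleGraph V) : Prop :=
  H.edgeSet.Nonempty ∧ (∀ a ∈ H.support, ∀ b ∈ H.support, H.Reachable a b) ∧
    ∀ v, ¬IsCutVertex H v

/-- `B` is a block of `H`: a maximal biconnected subgraph. -/
def IsBlock (H B : SimpleGraph V) : Prop :=
  B ≤ H ∧ IsBiconnected B ∧ ∀ B', B ≤ B' → B' ≤ H → IsBiconnected B' → B' = B

/-- A graph is a cycle (graph): its edge set is the edge set of a cycle of length `≥ 3`. -/
def IsCycleGraph (B : SimpleGraph V) : Prop :=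
  ∃ (n : ℕ) (f : ℕ → V), 3 ≤ n ∧
    (∀ i j, i < n → j < n → f i = f j → i = j) ∧
    B.edgeSet = {e | ∃ i, ∃ _ : i < n, e = s(f i, f ((i + 1) % n))}

/-- `v` is a sink of the block `B` of the walk `w`: a common vertex of two odd
(or two even) edges of the walk belonging to `B`. -/
def IsSinkOf {G : SimpleGraph V} (w : EvenClosedWalk G) (B : SimpleGraph V) (v : V) : Prop :=
  ∃ e₁ e₂ : Sym2 V, e₁ ≠ e₂ ∧ e₁ ∈ B.edgeSet ∧ e₂ ∈ B.edgeSet ∧ v ∈ e₁ ∧ v ∈ e₂ ∧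
    ((e₁ ∈ w.plusEdges ∧ e₂ ∈ w.plusEdges) ∨ (e₁ ∈ w.minusEdges ∧ e₂ ∈ w.minusEdges))

/-- `B` is a pure cyclic block of the walk `w`: a block of `𝐰` which is a cycle all of whose
edges lie in `w⁺`, or all in `w⁻`. -/
def IsPureCyclicBlock {G : SimpleGraph V} (w : EvenClosedWalk G) (B : SimpleGraph V) : Prop :=
  IsBlock w.graph B ∧ IsCycleGraph B ∧
    (B.edgeSet ⊆ w.plusEdges ∨ B.edgeSet ⊆ w.minusEdges)

/-- A primitive walk is mixed if it has no pure cyclic block. -/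
def EvenClosedWalk.IsMixed {G : SimpleGraph V} (w : EvenClosedWalk G) : Prop :=
  ∀ B : SimpleGraph V, ¬IsPureCyclicBlock w B

/-! ### Term orders coming from Mathlib's monomial orders -/

/-- The term order attached to a monomial order. -/
def TermOrder.ofMonomialOrder (m : MonomialOrder σ) : TermOrder σ where
  lo := LinearOrder.lift' m.toSyn m.toSyn.injective
  zero_min u := m.toSyn_monotone (zero_le : (0 : σ →₀ ℕ) ≤ u)
  add_right u v w h := by
    change m.toSyn (u + w) ≤ m.toSyn (v + w)
    rw [map_add, map_add]
    exact add_le_add_left (show m.toSyn u ≤ m.toSyn v from h) _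

theorem TermOrder.leadExp_mem_support (t : TermOrder σ) {f : MvPolynomial σ K} (hf : f ≠ 0) :
    t.leadExp f ∈ f.support := by
  rw [TermOrder.leadExp, dif_neg hf]
  exact @Finset.max'_mem _ t.lo _ _

theorem TermOrder.le_leadExp (t : TermOrder σ) {f : MvPolynomial σ K} {u : σ →₀ ℕ}
    (hu : u ∈ f.support) : t.lo.le u (t.leadExp f) := by
  have hf : f ≠ 0 := by rintro rfl; simp at hu
  rw [TermOrder.leadExp, dif_neg hf]
  exact @Finset.le_max' _ t.lo _ _ hu

theorem TermOrder.initial_zero (t : TermOrder σ) : t.initial (0 : MvPolynomial σ K) = 0 := by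
  simp [TermOrder.initial]

/-! ### Binomials -/

theorem coeff_binom_left {u v : σ →₀ ℕ} (h : u ≠ v) : (binom K u v).coeff u = 1 := by
  classical
  simp [binom, coeff_monomial, h.symm]

theorem support_binom [DecidableEq σ] {u v : σ →₀ ℕ} (h : u ≠ v) :
    (binom K u v).support = {u, v} := by
  ext w
  simp only [binom, mem_support_iff, coeff_sub, coeff_monomial, Finset.mem_insert,
    Finset.mem_singleton]
  by_cases h1 : u = w <;> by_cases h2 : v = w <;> simp_all [eq_comm]

theorem binom_ne_zero {u v : σ →₀ ℕ} (h : u ≠ v) : binom K u v ≠ 0 := fun h0 => by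
  have := coeff_binom_left (K := K) h
  simp [h0] at this

theorem vars_binom [DecidableEq σ] {u v : σ →₀ ℕ} (h : u ≠ v) :
    (binom K u v).vars = u.support ∪ v.support := by
  ext i
  simp [mem_vars_iff_mem_support, support_binom h]

theorem totalDegree_binom {u v : σ →₀ ℕ} (h : u ≠ v) :
    (binom K u v).totalDegree = max u.degree v.degree := by
  classical
  rw [totalDegree, support_binom h]
  simp [Finsupp.sum, Finsupp.degree_apply]

theorem leadExp_binom (m : MonomialOrder σ) {u v : σ →₀ ℕ} (h : m.toSyn v < m.toSyn u) :
    (TermOrder.ofMonomialOrder m).leadExp (binom K u v) = u := by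
  classical
  have huv : u ≠ v := by rintro rfl; exact lt_irrefl _ h
  have h1 := (TermOrder.ofMonomialOrder m).leadExp_mem_support (binom_ne_zero (K := K) huv)
  have h2 : m.toSyn u ≤ m.toSyn ((TermOrder.ofMonomialOrder m).leadExp (binom K u v)) :=
    (TermOrder.ofMonomialOrder m).le_leadExp (f := binom K u v) (by simp [support_binom huv])
  rw [support_binom huv, Finset.mem_insert, Finset.mem_singleton] at h1
  rcases h1 with h1 | h1
  · exact h1
  · rw [h1] at h2
    exact absurd h2 (not_le.mpr h)

theorem nonempty_monomialOrder.{u} (σ : Type u) [Finite σ] :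
    Nonempty (MonomialOrder.{u, u} σ) := by
  obtain ⟨_, -⟩ := exists_wellFoundedLT σ
  exact ⟨MonomialOrder.lex⟩

/-! ### Toric ideals as graded by fibres -/

/-- `I` behaves like the toric ideal of the grading `deg`: it contains all binomials that are
homogeneous for `deg`, and no polynomial of `I` has a monomial that is alone in its degree. -/
structure IsToricFor {Γ : Type*} [AddCommMonoid Γ] (I : Ideal (MvPolynomial σ K))
    (deg : (σ →₀ ℕ) →+ Γ) : Prop where
  binom_mem : ∀ {a b : σ →₀ ℕ}, deg a = deg b → binom K a b ∈ I
  exists_ne : ∀ {f}, f ∈ I → ∀ {a}, a ∈ f.support → ∃ b ∈ f.support, b ≠ a ∧ deg b = deg a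

namespace IsToricFor

variable {Γ : Type*} [AddCommMonoid Γ] {I : Ideal (MvPolynomial σ K)}
  {deg : (σ →₀ ℕ) →+ Γ}

theorem deg_eq (hI : IsToricFor I deg) {a b : σ →₀ ℕ} (h : binom K a b ∈ I) :
    deg a = deg b := by
  classical
  by_cases hab : a = b
  · rw [hab]
  obtain ⟨c, hc, hca, hd⟩ := hI.exists_ne h (a := a) (by simp [support_binom hab])
  rw [support_binom hab, Finset.mem_insert, Finset.mem_singleton] at hc
  rcases hc with rfl | rfl
  · exact absurd rfl hca
  · exact hd.symm

theorem not_isUnit (hI : IsToricFor I deg) {f : MvPolynomial σ K} (hf : f ∈ I) : ¬IsUnit f := by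
  intro hu
  have h1 : (1 : MvPolynomial σ K) ∈ I := by
    rw [Ideal.eq_top_of_isUnit_mem I hf hu]; trivial
  obtain ⟨b, hb, hb0, -⟩ := hI.exists_ne h1 (a := 0) (by simp)
  classical
  rw [mem_support_iff, MvPolynomial.coeff_one] at hb
  simp_all [eq_comm]

/-- A monomial is standard if it is the smallest one in its fibre. -/
def Standard (deg : (σ →₀ ℕ) →+ Γ) (m : MonomialOrder σ) (a : σ →₀ ℕ) : Prop :=
  ∀ b, deg b = deg a → m.toSyn a ≤ m.toSyn b

theorem Standard.of_le {m : MonomialOrder σ} {a b : σ →₀ ℕ} (hb : Standard deg m b)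
    (hab : a ≤ b) : Standard deg m a := by
  intro c hc
  obtain ⟨d, rfl⟩ := exists_add_of_le hab
  have h := hb (c + d) (by rw [map_add, map_add, hc])
  rw [map_add, map_add] at h
  exact le_of_add_le_add_right h

theorem exists_standard (deg : (σ →₀ ℕ) →+ Γ) (m : MonomialOrder σ) (a : σ →₀ ℕ) :
    ∃ b, deg b = deg a ∧ Standard deg m b := by
  have hwf : WellFounded (fun a b : σ →₀ ℕ => m.toSyn a < m.toSyn b) :=
    InvImage.wf m.toSyn wellFounded_lt
  obtain ⟨b, hb, hmin⟩ := hwf.has_min {b | deg b = deg a} ⟨a, rfl⟩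
  exact ⟨b, hb, fun c hc => not_lt.mp (hmin c (hc.trans hb))⟩

/-- If the fibre of `u` is `{u, v}` and `u`, `v` have disjoint supports, then the binomial
`x^u - x^v` belongs to the reduced Gröbner basis of every term order with `v < u`. -/
theorem mem_universalGB [Finite σ] (hI : IsToricFor I deg) (m : MonomialOrder σ)
    {u v : σ →₀ ℕ} (huv : deg u = deg v) (hfib : ∀ a, deg a = deg u → a = u ∨ a = v)
    (hdisj : ∀ i, u i = 0 ∨ v i = 0) (hlt : m.toSyn v < m.toSyn u) :
    binom K u v ∈ UniversalGB I := by
  classical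
  choose nf nf_deg nf_std using exists_standard deg m
  set t := TermOrder.ofMonomialOrder m
  set S : Set (σ →₀ ℕ) := {a | Minimal (fun b => ¬Standard deg m b) a}
  have minimal : ∀ a ∈ S, Minimal (fun b => ¬Standard deg m b) a := fun _ h => h
  have hSfin : S.Finite :=
    (setOfPred_minimal_antichain _).finite_of_partiallyWellOrderedOn
      (Set.isPWO_of_wellQuasiOrderedLE _)
  have nf_lt : ∀ a, ¬Standard deg m a → m.toSyn (nf a) < m.toSyn a := by
    intro a ha
    refine lt_of_le_of_ne (nf_std a a (nf_deg a).symm) fun h => ha ?_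
    rw [← m.toSyn.injective h]
    exact nf_std a
  have lead : ∀ a ∈ S, t.leadExp (binom K a (nf a)) = a := fun a ha =>
    leadExp_binom m (nf_lt a (minimal a ha).prop)
  have ne_nf : ∀ a ∈ S, a ≠ nf a := fun a ha h => by
    have := nf_lt a (minimal a ha).prop
    rw [← h] at this
    exact lt_irrefl _ this
  have mem : ∀ a, binom K a (nf a) ∈ I := fun a => hI.binom_mem (nf_deg a).symm
  refine ⟨t, hSfin.toFinset.image fun a => binom K a (nf a), ⟨⟨?_, ?_⟩, ?_, ?_⟩, ?_⟩
  · intro f hf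
    simp only [Finset.coe_image, Set.mem_image] at hf
    obtain ⟨a, -, rfl⟩ := hf
    exact mem a
  · apply le_antisymm
    · refine Ideal.span_mono (Set.image_mono ?_)
      intro f hf
      simp only [Finset.coe_image, Set.mem_image] at hf
      obtain ⟨a, -, rfl⟩ := hf
      exact mem a
    · rw [Ideal.span_le]
      rintro _ ⟨f, hf, rfl⟩
      by_cases hf0 : f = 0
      · rw [hf0, t.initial_zero]
        exact Ideal.zero_mem _
      have hl := t.leadExp_mem_support hf0
      have hns : ¬Standard deg m (t.leadExp f) := by
        intro hs
        obtain ⟨b, hb, hne, hd⟩ := hI.exists_ne hf hl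
        have h1 : m.toSyn b ≤ m.toSyn (t.leadExp f) := t.le_leadExp hb
        exact hne (m.toSyn.injective (le_antisymm h1 (hs b hd)))
      obtain ⟨a, hale, ha⟩ := exists_minimal_le_of_wellFoundedLT
        (fun b => ¬Standard deg m b) _ hns
      obtain ⟨d, hd⟩ := exists_add_of_le hale
      have key : t.initial f = monomial d (f.coeff (t.leadExp f)) *
          t.initial (binom K a (nf a)) := by
        rw [TermOrder.initial, TermOrder.initial, lead a ha, coeff_binom_left (ne_nf a ha),
          monomial_mul, mul_one, add_comm d a, ← hd]
      rw [key]
      refine Ideal.mul_mem_left _ _ (Ideal.subset_span ⟨_, ?_, rfl⟩)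
      simp only [Finset.coe_image, Set.mem_image, Set.Finite.coe_toFinset]
      exact ⟨a, ha, rfl⟩
  · intro g hg
    simp only [Finset.mem_image, Set.Finite.mem_toFinset] at hg
    obtain ⟨a, ha, rfl⟩ := hg
    rw [lead a ha, coeff_binom_left (ne_nf a ha)]
  · intro g hg g' hg' hne w hw hle
    simp only [Finset.mem_image, Set.Finite.mem_toFinset] at hg hg'
    obtain ⟨a, ha, rfl⟩ := hg
    obtain ⟨b, hb, rfl⟩ := hg'
    rw [lead b hb] at hle
    rw [support_binom (ne_nf a ha), Finset.mem_insert, Finset.mem_singleton] at hw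
    rcases hw with rfl | rfl
    · exact hne (by rw [(minimal w ha).eq_of_le (minimal b hb).prop hle])
    · exact (minimal b hb).prop ((nf_std a).of_le hle)
  · simp only [Finset.mem_image, Set.Finite.mem_toFinset]
    have hu : ¬Standard deg m u := fun h => absurd (h v huv.symm) (not_le.mpr hlt)
    refine ⟨u, ⟨hu, ?_⟩, ?_⟩
    · intro w hw hwu
      by_contra hcon
      obtain ⟨d, hd⟩ := exists_add_of_le hwu
      refine hw fun b hb => ?_
      rcases hfib (b + d) (by rw [hd, map_add, map_add, hb]) with h | h
      · rw [hd] at h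
        rw [add_right_cancel h]
      · refine absurd ?_ hcon
        have hd0 : d = 0 := by
          ext i
          have h1 := DFunLike.congr_fun h i
          have h2 := DFunLike.congr_fun hd i
          have := hdisj i
          simp only [Finsupp.add_apply, Finsupp.zero_apply] at *
          omega
        rw [hd, hd0, add_zero]
    · rcases hfib (nf u) (nf_deg u) with h | h
      · exact absurd (h ▸ nf_std u) hu
      · rw [h]

/-! ### Irreducible homogeneous binomials -/

theorem disjoint_of_irreducible [IsCancelAdd Γ] (hI : IsToricFor I deg) {a b : σ →₀ ℕ}
    (hirr : Irreducible (binom K a b)) (hab : deg a = deg b) (i : σ) : a i = 0 ∨ b i = 0 := by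
  classical
  by_contra! hcon
  obtain ⟨c, rfl⟩ : ∃ c, a = Finsupp.single i 1 + c :=
    exists_add_of_le (by simpa using Nat.one_le_iff_ne_zero.mpr hcon.1)
  obtain ⟨d, rfl⟩ : ∃ d, b = Finsupp.single i 1 + d :=
    exists_add_of_le (by simpa using Nat.one_le_iff_ne_zero.mpr hcon.2)
  rw [map_add, map_add] at hab
  have h : binom K (Finsupp.single i 1 + c) (Finsupp.single i 1 + d) =
      monomial (Finsupp.single i 1) 1 * binom K c d := by
    simp [binom, mul_sub, monomial_mul]
  rcases hirr.isUnit_or_isUnit h with h | h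
  · have := h.map (constantCoeff (R := K) (σ := σ))
    simp [constantCoeff_monomial] at this
  · exact hI.not_isUnit (hI.binom_mem (add_left_cancel hab)) h

theorem le_one_of_irreducible (hI : IsToricFor I deg) {a b : σ →₀ ℕ} {n : ℕ} (ha : a ≠ 0)
    (hb : b ≠ 0) (hab : deg a = deg b) (hirr : Irreducible (binom K (n • a) (n • b))) :
    n ≤ 1 := by
  by_contra! hn
  have h : binom K (n • a) (n • b) =
      (∑ i ∈ Finset.range n, monomial a (1 : K) ^ i * monomial b 1 ^ (n - 1 - i)) *
        binom K a b := by
    simp only [binom]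
    rw [(Commute.all _ _).geom_sum₂_mul]
    simp [monomial_pow]
  rcases hirr.isUnit_or_isUnit h with h | h
  · have := h.map (constantCoeff (R := K) (σ := σ))
    rw [map_sum, Finset.sum_eq_zero] at this
    · simp at this
    · classical
      intro i hi
      rw [Finset.mem_range] at hi
      simp only [map_mul, map_pow, constantCoeff_monomial, ha, hb, if_false]
      rcases Nat.eq_zero_or_pos i with rfl | hi
      · rw [zero_pow (by omega : n - 1 - 0 ≠ 0), mul_zero]
      · rw [zero_pow (by omega), zero_mul]
  · exact hI.not_isUnit (hI.binom_mem hab) h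

end IsToricFor

/-! ### The toric ideal of a graph is graded by vertex degrees -/

/-- The exponent vector of the image `x_u * x_v` of an edge `{u, v}`. -/
def edgeExp (e : Sym2 V) : V →₀ ℕ :=
  Sym2.lift ⟨fun a b => Finsupp.single a 1 + Finsupp.single b 1, fun _ _ => add_comm _ _⟩ e

theorem edgeImage_eq_monomial (e : Sym2 V) : edgeImage K e = monomial (edgeExp e) 1 := by
  induction e with
  | h a b => simp [edgeImage, edgeExp, X, monomial_mul]

/-- The degree of a monomial in the edges at every vertex. -/
def vertexDeg (G : SimpleGraph V) : (G.edgeSet →₀ ℕ) →+ (V →₀ ℕ) :=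
  (Finsupp.linearCombination ℕ fun e : G.edgeSet => edgeExp (e : Sym2 V)).toAddMonoidHom

theorem vertexDeg_apply (G : SimpleGraph V) (a : G.edgeSet →₀ ℕ) :
    vertexDeg G a = a.sum fun e n => n • edgeExp (e : Sym2 V) := rfl

theorem aeval_edgeImage_monomial (G : SimpleGraph V) (a : G.edgeSet →₀ ℕ) (c : K) :
    aeval (fun e : G.edgeSet => edgeImage K (e : Sym2 V)) (monomial a c) =
      monomial (vertexDeg G a) c := by
  rw [aeval_monomial, vertexDeg_apply, monomial_finsupp_sum_index]
  simp [edgeImage_eq_monomial, monomial_pow, algebraMap_eq]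

theorem isToricFor_graphToricIdeal (G : SimpleGraph V) :
    IsToricFor (graphToricIdeal K G) (vertexDeg G) where
  binom_mem {a b} h := by
    change aeval (fun e : G.edgeSet => edgeImage K (e : Sym2 V)) (binom K a b) = 0
    rw [binom, map_sub, aeval_edgeImage_monomial, aeval_edgeImage_monomial, h, sub_self]
  exists_ne {f} hf a ha := by
    classical
    by_contra! hcon
    replace hf : aeval (fun e : G.edgeSet => edgeImage K (e : Sym2 V)) f = 0 := hf
    rw [f.as_sum, map_sum] at hf
    have h := congrArg (coeff (vertexDeg G a)) hf
    simp only [aeval_edgeImage_monomial, coeff_sum, coeff_monomial] at h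
    rw [Finset.sum_eq_single a] at h
    · simp at h
      exact (mem_support_iff.mp ha) h
    · intro b hb hne
      rw [if_neg (hcon b hb hne)]
    · exact fun h' => absurd ha h'

theorem degree_vertexDeg (G : SimpleGraph V) (a : G.edgeSet →₀ ℕ) :
    (vertexDeg G a).degree = 2 * a.degree := by
  have h : ∀ e : Sym2 V, (edgeExp e).degree = 2 := fun e => by
    induction e with
    | h a b => simp [edgeExp]
  rw [vertexDeg_apply, Finsupp.sum, map_sum, Finsupp.degree_apply, Finset.mul_sum]
  simp [h, mul_comm]

theorem degree_eq_of_vertexDeg_eq {G : SimpleGraph V} {a b : G.edgeSet →₀ ℕ}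
    (h : vertexDeg G a = vertexDeg G b) : a.degree = b.degree := by
  have h1 := degree_vertexDeg G a
  rw [h, degree_vertexDeg] at h1
  omega

theorem vertexDeg_apply_of_equiv {ε : Type*} [Fintype ε] [DecidableEq V] (G : SimpleGraph V)
    (E : ε ≃ G.edgeSet) (src dst : ε → V) (hE : ∀ e, (E e : Sym2 V) = s(src e, dst e))
    (a : G.edgeSet →₀ ℕ) (x : V) :
    vertexDeg G a x =
      ∑ e, a (E e) * ((if src e = x then 1 else 0) + (if dst e = x then 1 else 0)) := by
  have : Fintype G.edgeSet := Fintype.ofEquiv ε E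
  rw [vertexDeg_apply, Finsupp.sum_fintype _ _ (by simp), Finsupp.finsetSum_apply,
    ← Equiv.sum_comp E]
  refine Finset.sum_congr rfl fun e _ => ?_
  rw [hE]
  simp [edgeExp, Finsupp.single_apply, mul_add]

/-! ### Three odd cycles hanging on a nonagon -/

namespace HangingCycles

variable (M : ℕ)

/-- Vertex `(i, j)` with `j ≤ 2 * M` is the `j`-th vertex of the `i`-th odd cycle, with `j = 0`
the vertex on the nonagon; `(i, 2 * M + 1)` and `(i, 2 * M + 2)` are the two vertices on the
nonagon between `(i, 0)` and `(i + 1, 0)`. -/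
abbrev Vert := Fin 3 × Fin (2 * M + 3)

/-- Edge `(i, j)` with `j ≤ 2 * M` is the `j`-th edge of the `i`-th odd cycle; the edges
`(i, 2 * M + 3)`, `(i, 2 * M + 1)`, `(i, 2 * M + 2)` are, in this order, the edges of the nonagon
from `(i, 0)` to `(i + 1, 0)`. -/
abbrev Edge := Fin 3 × Fin (2 * M + 4)

variable {M}

/-- The first endpoint of an edge. -/
def src (e : Edge M) : Vert M :=
  (e.1, ⟨if (e.2 : ℕ) < 2 * M + 3 then e.2 else 0, by split_ifs <;> omega⟩)

/-- The second endpoint of an edge. -/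
def dst (e : Edge M) : Vert M :=
  (if (e.2 : ℕ) = 2 * M + 2 then e.1 + 1 else e.1,
    ⟨if (e.2 : ℕ) < 2 * M then e.2 + 1 else if (e.2 : ℕ) = 2 * M + 1 then 2 * M + 2
      else if (e.2 : ℕ) = 2 * M + 3 then 2 * M + 1 else 0, by split_ifs <;> omega⟩)

theorem val_add_one (i : Fin 3) : ((i + 1 : Fin 3) : ℕ) = (i + 1) % 3 := by
  simp [Fin.val_add]

theorem val_add_two (i : Fin 3) : ((i + 2 : Fin 3) : ℕ) = (i + 2) % 3 := by
  simp [Fin.val_add]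

theorem src_eq_iff (e : Edge M) (x : Vert M) :
    src e = x ↔ (e.1 : ℕ) = x.1 ∧
      ((e.2 : ℕ) < 2 * M + 3 ∧ (x.2 : ℕ) = e.2 ∨ (e.2 : ℕ) = 2 * M + 3 ∧ (x.2 : ℕ) = 0) := by
  simp only [src, Prod.ext_iff, Fin.ext_iff]
  have := e.2.isLt
  split_ifs <;> omega

theorem dst_eq_iff (e : Edge M) (x : Vert M) :
    dst e = x ↔ (e.1 : ℕ) = x.1 ∧
      ((e.2 : ℕ) < 2 * M ∧ (x.2 : ℕ) = e.2 + 1 ∨ (e.2 : ℕ) = 2 * M ∧ (x.2 : ℕ) = 0 ∨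
        (e.2 : ℕ) = 2 * M + 1 ∧ (x.2 : ℕ) = 2 * M + 2 ∨
        (e.2 : ℕ) = 2 * M + 3 ∧ (x.2 : ℕ) = 2 * M + 1) ∨
      (e.2 : ℕ) = 2 * M + 2 ∧ (x.1 : ℕ) = (e.1 + 1) % 3 ∧ (x.2 : ℕ) = 0 := by
  simp only [dst, Prod.ext_iff, Fin.ext_iff]
  have := e.2.isLt
  have := val_add_one e.1
  split_ifs <;> omega

theorem src_ne_dst (hM : 0 < M) (e : Edge M) : src e ≠ dst e := by
  intro h
  have h1 := (src_eq_iff e _).mp rfl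
  have h2 := (dst_eq_iff e _).mp h.symm
  omega

theorem endpoints_injective :
    Function.Injective fun e : Edge M => s(src e, dst e) := by
  intro e e' h
  rw [Sym2.eq_iff] at h
  have h1 := (src_eq_iff e' _).mp rfl
  have h2 := (dst_eq_iff e' _).mp rfl
  simp only [src_eq_iff, dst_eq_iff] at h
  simp only [Prod.ext_iff, Fin.ext_iff]
  omega

/-- A nonagon with an odd cycle of length `2 * M + 1` hanging on every third vertex. -/
def graph (M : ℕ) : SimpleGraph (Vert M) :=
  SimpleGraph.fromEdgeSet (Set.range fun e : Edge M => s(src e, dst e))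

theorem edgeSet_graph (hM : 0 < M) :
    (graph M).edgeSet = Set.range fun e : Edge M => s(src e, dst e) := by
  rw [graph, SimpleGraph.edgeSet_fromEdgeSet, sdiff_eq_left, Set.disjoint_left]
  rintro _ ⟨e, rfl⟩ h
  exact src_ne_dst hM e (by simpa using h)

/-- The enumeration of the edges of the graph. -/
def edgeEquiv (hM : 0 < M) : Edge M ≃ (graph M).edgeSet :=
  (Equiv.ofInjective _ endpoints_injective).trans (Equiv.setCongr (edgeSet_graph hM).symm)

theorem coe_edgeEquiv (hM : 0 < M) (e : Edge M) :
    (edgeEquiv hM e : Sym2 (Vert M)) = s(src e, dst e) := rfl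

theorem adj_src_dst (hM : 0 < M) (e : Edge M) : (graph M).Adj (src e) (dst e) :=
  (edgeEquiv hM e).2

theorem connected_graph (hM : 0 < M) : (graph M).Connected := by
  have step : ∀ (e : Edge M) (x y : Vert M), src e = x → dst e = y → (graph M).Reachable x y := by
    rintro e x y rfl rfl
    exact (adj_src_dst hM e).reachable
  have hp : ∀ i, (graph M).Reachable (i, 0) (i, ⟨2 * M + 1, by omega⟩) := fun i =>
    step (i, ⟨2 * M + 3, by omega⟩) _ _ (by simp [src_eq_iff]) (by simp [dst_eq_iff])
  have hq : ∀ i, (graph M).Reachable (i, 0) (i, ⟨2 * M + 2, by omega⟩) := fun i =>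
    (hp i).trans
      (step (i, ⟨2 * M + 1, by omega⟩) _ _ (by simp [src_eq_iff]) (by simp [dst_eq_iff]))
  have hnext : ∀ i, (graph M).Reachable (i, 0) (i + 1, 0) := fun i =>
    (hq i).trans
      (step (i, ⟨2 * M + 2, by omega⟩) _ _ (by simp [src_eq_iff]) (by simp [dst_eq_iff, val_add_one]))
  have hloop : ∀ i (j : ℕ) (hj : j ≤ 2 * M), (graph M).Reachable (i, 0) (i, ⟨j, by omega⟩) := by
    intro i j
    induction j with
    | zero => exact fun _ => .rfl
    | succ j ih =>
      intro hj
      refine (ih (by omega)).trans (step (i, ⟨j, by omega⟩) _ _ ?_ ?_)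
      · rw [src_eq_iff]; dsimp only; omega
      · rw [dst_eq_iff]; dsimp only; omega
  have hhub : ∀ i, (graph M).Reachable (0, 0) (i, 0) := by
    intro i
    fin_cases i
    · exact .rfl
    · exact hnext 0
    · exact (hnext 0).trans (hnext 1)
  have : Nonempty (Vert M) := ⟨(0, 0)⟩
  refine SimpleGraph.Connected.mk fun x y => ?_
  have h : ∀ x : Vert M, (graph M).Reachable (0, 0) x := by
    rintro ⟨i, j, hj⟩
    refine (hhub i).trans ?_
    by_cases h1 : j ≤ 2 * M
    · exact hloop i j h1
    by_cases h2 : j = 2 * M + 1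
    · subst h2; exact hp i
    · obtain rfl : j = 2 * M + 2 := by omega
      exact hq i
  exact (h x).symm.trans (h y)

section degrees

variable (hM : 0 < M) (a : (graph M).edgeSet →₀ ℕ) (i : Fin 3)

theorem vertexDeg_hub :
    vertexDeg (graph M) a (i, 0) = a (edgeEquiv hM (i, ⟨0, by omega⟩)) +
      a (edgeEquiv hM (i, ⟨2 * M, by omega⟩)) + a (edgeEquiv hM (i, ⟨2 * M + 3, by omega⟩)) +
      a (edgeEquiv hM (i + 2, ⟨2 * M + 2, by omega⟩)) := by
  have key : ∀ e : Edge M, ((if src e = (i, 0) then 1 else 0) + (if dst e = (i, 0) then 1 else 0)) =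
      (if e = (i, ⟨0, by omega⟩) then 1 else 0) + (if e = (i, ⟨2 * M, by omega⟩) then 1 else 0) +
      (if e = (i, ⟨2 * M + 3, by omega⟩) then 1 else 0) +
      (if e = (i + 2, ⟨2 * M + 2, by omega⟩) then 1 else 0) := by
    rintro ⟨k, j, hj⟩
    simp only [src_eq_iff, dst_eq_iff, Prod.mk.injEq, Fin.ext_iff, Fin.val_zero]
    have := val_add_two i
    split_ifs <;>
      simp only [and_false, and_true, or_false, false_or] at * <;> omega
  rw [vertexDeg_apply_of_equiv _ (edgeEquiv hM) src dst (coe_edgeEquiv hM)]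
  simp only [key, mul_add, Finset.sum_add_distrib, mul_ite, mul_one, mul_zero, Finset.sum_ite_eq',
    Finset.mem_univ, if_true]

theorem vertexDeg_loop {j : ℕ} (hj : j < 2 * M) :
    vertexDeg (graph M) a (i, ⟨j + 1, by omega⟩) = a (edgeEquiv hM (i, ⟨j, by omega⟩)) +
      a (edgeEquiv hM (i, ⟨j + 1, by omega⟩)) := by
  have key : ∀ e : Edge M, ((if src e = (i, ⟨j + 1, by omega⟩) then 1 else 0) +
      (if dst e = (i, ⟨j + 1, by omega⟩) then 1 else 0)) =
      (if e = (i, ⟨j, by omega⟩) then 1 else 0) +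
      (if e = (i, ⟨j + 1, by omega⟩) then 1 else 0) := by
    rintro ⟨k, j, hj⟩
    simp only [src_eq_iff, dst_eq_iff, Prod.mk.injEq, Fin.ext_iff]
    split_ifs <;>
      simp only [and_false, or_false, false_or] at * <;> omega
  rw [vertexDeg_apply_of_equiv _ (edgeEquiv hM) src dst (coe_edgeEquiv hM)]
  simp only [key, mul_add, Finset.sum_add_distrib, mul_ite, mul_one, mul_zero, Finset.sum_ite_eq',
    Finset.mem_univ, if_true]

theorem vertexDeg_first :
    vertexDeg (graph M) a (i, ⟨2 * M + 1, by omega⟩) =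
      a (edgeEquiv hM (i, ⟨2 * M + 3, by omega⟩)) +
      a (edgeEquiv hM (i, ⟨2 * M + 1, by omega⟩)) := by
  have key : ∀ e : Edge M, ((if src e = (i, ⟨2 * M + 1, by omega⟩) then 1 else 0) +
      (if dst e = (i, ⟨2 * M + 1, by omega⟩) then 1 else 0)) =
      (if e = (i, ⟨2 * M + 3, by omega⟩) then 1 else 0) +
      (if e = (i, ⟨2 * M + 1, by omega⟩) then 1 else 0) := by
    rintro ⟨k, j, hj⟩
    simp only [src_eq_iff, dst_eq_iff, Prod.mk.injEq, Fin.ext_iff]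
    split_ifs <;>
      simp only [and_false, and_true, or_false, false_or] at * <;> omega
  rw [vertexDeg_apply_of_equiv _ (edgeEquiv hM) src dst (coe_edgeEquiv hM)]
  simp only [key, mul_add, Finset.sum_add_distrib, mul_ite, mul_one, mul_zero, Finset.sum_ite_eq',
    Finset.mem_univ, if_true]

theorem vertexDeg_second :
    vertexDeg (graph M) a (i, ⟨2 * M + 2, by omega⟩) =
      a (edgeEquiv hM (i, ⟨2 * M + 1, by omega⟩)) +
      a (edgeEquiv hM (i, ⟨2 * M + 2, by omega⟩)) := by
  have key : ∀ e : Edge M, ((if src e = (i, ⟨2 * M + 2, by omega⟩) then 1 else 0) +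
      (if dst e = (i, ⟨2 * M + 2, by omega⟩) then 1 else 0)) =
      (if e = (i, ⟨2 * M + 1, by omega⟩) then 1 else 0) +
      (if e = (i, ⟨2 * M + 2, by omega⟩) then 1 else 0) := by
    rintro ⟨k, j, hj⟩
    simp only [src_eq_iff, dst_eq_iff, Prod.mk.injEq, Fin.ext_iff]
    split_ifs <;>
      simp only [and_false, and_true, or_false, false_or] at * <;> omega
  rw [vertexDeg_apply_of_equiv _ (edgeEquiv hM) src dst (coe_edgeEquiv hM)]
  simp only [key, mul_add, Finset.sum_add_distrib, mul_ite, mul_one, mul_zero, Finset.sum_ite_eq',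
    Finset.mem_univ, if_true]

end degrees
/-! ### The kernel of the vertex degree map -/

/-- The combination of the labels of the odd cycles that occurs on the path from `(i, 0)` to
`(i + 1, 0)`. -/
def turn (β : Fin 3 → ℤ) (i : Fin 3) : ℤ := β i + β (i + 1) - β (i + 2)

variable (M) in
/-- The vector in the kernel of the vertex degree map with value `β i` at the edge `(i, 0)`. -/
def kerVec (β : Fin 3 → ℤ) (i : Fin 3) (j : ℕ) : ℤ :=
  if j < 2 * M + 1 then (if j % 2 = 0 then β i else -β i)
  else if j = 2 * M + 1 then turn β i else -turn β i

theorem turn_neg (β : Fin 3 → ℤ) (i : Fin 3) : turn (-β) i = -turn β i := by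
  simp only [turn, Pi.neg_apply]
  ring

theorem kerVec_neg (β : Fin 3 → ℤ) (i : Fin 3) (j : ℕ) : kerVec M (-β) i j = -kerVec M β i j := by
  simp only [kerVec, turn_neg, Pi.neg_apply]
  split_ifs <;> rfl

theorem kerVec_smul (n : ℤ) (β : Fin 3 → ℤ) (i : Fin 3) (j : ℕ) :
    kerVec M (n • β) i j = n * kerVec M β i j := by
  simp only [kerVec, turn, Pi.smul_apply, smul_eq_mul]
  split_ifs <;> ring

theorem vertexDeg_eq_iff (hM : 0 < M) (a b : (graph M).edgeSet →₀ ℕ) :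
    vertexDeg (graph M) a = vertexDeg (graph M) b ↔ ∃ β : Fin 3 → ℤ, ∀ e : Edge M,
      (a (edgeEquiv hM e) : ℤ) - b (edgeEquiv hM e) = kerVec M β e.1 e.2 := by
  have e1 : ∀ i : Fin 3, i + 1 + 2 = i := by decide
  have e2 : ∀ i : Fin 3, i + 2 + 2 = i + 1 := by decide
  have e3 : ∀ i : Fin 3, i + 2 + 1 = i := by decide
  constructor
  · intro h
    have hx : ∀ x, vertexDeg (graph M) a x = vertexDeg (graph M) b x := fun x => by rw [h]
    set β : Fin 3 → ℤ := fun i =>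
      (a (edgeEquiv hM (i, ⟨0, by omega⟩)) : ℤ) - b (edgeEquiv hM (i, ⟨0, by omega⟩)) with hβ
    have hβi : ∀ i, β i =
      (a (edgeEquiv hM (i, ⟨0, by omega⟩)) : ℤ) - b (edgeEquiv hM (i, ⟨0, by omega⟩)) :=
      fun _ => rfl
    clear_value β
    have hloop : ∀ i j (hj : j < 2 * M + 1), (a (edgeEquiv hM (i, ⟨j, by omega⟩)) : ℤ) -
        b (edgeEquiv hM (i, ⟨j, by omega⟩)) = if j % 2 = 0 then β i else -β i := by
      intro i j
      induction j with
      | zero => intro _; simp [hβi]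
      | succ j ih =>
        intro hj
        have h1 := hx (i, ⟨j + 1, by omega⟩)
        rw [vertexDeg_loop hM _ _ (by omega), vertexDeg_loop hM _ _ (by omega)] at h1
        have h2 := ih (by omega)
        split_ifs at h2 ⊢ <;> omega
    have hfirst : ∀ i, _ := fun i => hx (i, ⟨2 * M + 1, by omega⟩)
    have hsecond : ∀ i, _ := fun i => hx (i, ⟨2 * M + 2, by omega⟩)
    have hhub : ∀ i, _ := fun i => hx (i, 0)
    simp only [vertexDeg_first hM, vertexDeg_second hM, vertexDeg_hub hM] at hfirst hsecond hhub
    have hlast : ∀ i, _ := fun i => hloop i (2 * M) (by omega)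
    simp only [Nat.mul_mod_right, if_true] at hlast
    have hturn : ∀ i, (a (edgeEquiv hM (i, ⟨2 * M + 1, by omega⟩)) : ℤ) -
        b (edgeEquiv hM (i, ⟨2 * M + 1, by omega⟩)) = turn β i := by
      intro i
      have g0 := hhub i
      have g1 := hhub (i + 1)
      have g2 := hhub (i + 2)
      rw [e1] at g1
      rw [e2] at g2
      have := hfirst i
      have := hfirst (i + 1)
      have := hfirst (i + 2)
      have := hsecond i
      have := hsecond (i + 1)
      have := hsecond (i + 2)
      have := hlast i
      have := hlast (i + 1)
      have := hlast (i + 2)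
      have := hβi i
      have := hβi (i + 1)
      have := hβi (i + 2)
      rw [turn]
      omega
    refine ⟨β, ?_⟩
    rintro ⟨i, j, hj⟩
    simp only [kerVec]
    have := hturn i
    have := hfirst i
    have := hsecond i
    by_cases h1 : j < 2 * M + 1
    · rw [if_pos h1]
      exact hloop i j h1
    rw [if_neg h1]
    by_cases h2 : j = 2 * M + 1
    · subst h2
      rw [if_pos rfl]
      omega
    rw [if_neg h2]
    by_cases h3 : j = 2 * M + 2
    · subst h3
      omega
    · obtain rfl : j = 2 * M + 3 := by omega
      omega
  · rintro ⟨β, h⟩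
    ext x
    obtain ⟨i, j, hj⟩ := x
    have h1 := h (i, ⟨2 * M + 1, by omega⟩)
    have h2 := h (i, ⟨2 * M + 2, by omega⟩)
    have h3 := h (i, ⟨2 * M + 3, by omega⟩)
    have h4 := h (i + 2, ⟨2 * M + 2, by omega⟩)
    simp only [kerVec, turn, e2, e3] at h1 h2 h3 h4
    rw [if_neg (by omega)] at h1 h2 h3 h4
    rw [if_neg (by omega)] at h2 h3 h4
    rw [if_pos trivial] at h1
    by_cases j1 : j = 0
    · subst j1
      have h5 := h (i, ⟨0, by omega⟩)
      have h6 := h (i, ⟨2 * M, by omega⟩)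
      simp only [kerVec] at h5 h6
      have := vertexDeg_hub hM a i
      have := vertexDeg_hub hM b i
      change vertexDeg (graph M) a (i, 0) = vertexDeg (graph M) b (i, 0)
      split_ifs at h5 h6 <;> omega
    by_cases j2 : j < 2 * M + 1
    · obtain ⟨j, rfl⟩ : ∃ k, j = k + 1 := ⟨j - 1, by omega⟩
      have h5 := h (i, ⟨j, by omega⟩)
      have h6 := h (i, ⟨j + 1, by omega⟩)
      simp only [kerVec] at h5 h6
      rw [if_pos (by omega)] at h5 h6
      rw [vertexDeg_loop hM a i (by omega), vertexDeg_loop hM b i (by omega)]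
      split_ifs at h5 h6 <;> omega
    by_cases j3 : j = 2 * M + 1
    · subst j3
      rw [vertexDeg_first hM, vertexDeg_first hM]
      omega
    · obtain rfl : j = 2 * M + 2 := by omega
      rw [vertexDeg_second hM, vertexDeg_second hM]
      omega

/-- The positive part of a kernel vector, as an exponent vector. -/
def part (hM : 0 < M) (β : Fin 3 → ℤ) : (graph M).edgeSet →₀ ℕ :=
  Finsupp.equivFunOnFinite.symm fun e =>
    (kerVec M β ((edgeEquiv hM).symm e).1 ((edgeEquiv hM).symm e).2).toNat

theorem part_apply (hM : 0 < M) (β : Fin 3 → ℤ) (e : Edge M) :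
    part hM β (edgeEquiv hM e) = (kerVec M β e.1 e.2).toNat := by
  simp [part]

theorem ext_edge (hM : 0 < M) {a b : (graph M).edgeSet →₀ ℕ}
    (h : ∀ e, a (edgeEquiv hM e) = b (edgeEquiv hM e)) : a = b := by
  ext e
  simpa using h ((edgeEquiv hM).symm e)

theorem vertexDeg_part (hM : 0 < M) (β : Fin 3 → ℤ) :
    vertexDeg (graph M) (part hM β) = vertexDeg (graph M) (part hM (-β)) := by
  rw [vertexDeg_eq_iff hM]
  refine ⟨β, fun e => ?_⟩
  rw [part_apply, part_apply, kerVec_neg]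
  omega

theorem part_eq_zero_or (hM : 0 < M) (β : Fin 3 → ℤ) (e : (graph M).edgeSet) :
    part hM β e = 0 ∨ part hM (-β) e = 0 := by
  obtain ⟨e, rfl⟩ := (edgeEquiv hM).surjective e
  rw [part_apply, part_apply, kerVec_neg]
  omega

theorem eq_part (hM : 0 < M) {a b : (graph M).edgeSet →₀ ℕ} {β : Fin 3 → ℤ}
    (hab : ∀ e, a e = 0 ∨ b e = 0)
    (h : ∀ e : Edge M, (a (edgeEquiv hM e) : ℤ) - b (edgeEquiv hM e) = kerVec M β e.1 e.2) :
    a = part hM β ∧ b = part hM (-β) := by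
  constructor <;> refine ext_edge hM fun e => ?_ <;>
    have h1 := h e <;> have h2 := hab (edgeEquiv hM e) <;>
    rw [part_apply] <;> try rw [kerVec_neg]
  all_goals omega

theorem part_smul (hM : 0 < M) (n : ℕ) (β : Fin 3 → ℤ) :
    part hM ((n : ℤ) • β) = n • part hM β := by
  refine ext_edge hM fun e => ?_
  rw [part_apply, kerVec_smul, Finsupp.smul_apply, part_apply, smul_eq_mul]
  rcases le_total 0 (kerVec M β e.1 e.2) with h | h
  · lift kerVec M β e.1 e.2 to ℕ using h with k
    norm_cast
  · rw [Int.toNat_of_nonpos h, mul_zero,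
      Int.toNat_of_nonpos (mul_nonpos_of_nonneg_of_nonpos (by omega) h)]

theorem two_mul_degree_part (hM : 0 < M) (β : Fin 3 → ℤ) :
    (2 * (part hM β).degree : ℤ) =
      (2 * M + 1) * (|β 0| + |β 1| + |β 2|) + 3 * (|turn β 0| + |turn β 1| + |turn β 2|) := by
  have hrow : ∀ i, ∑ j : Fin (2 * M + 4), |kerVec M β i j| =
      (2 * M + 1) * |β i| + 3 * |turn β i| := by
    intro i
    rw [Fin.sum_univ_eq_sum_range (fun j => |kerVec M β i j|), Finset.sum_range_succ,
      Finset.sum_range_succ, Finset.sum_range_succ,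
      Finset.sum_congr rfl (g := fun _ => |β i|)]
    · simp [kerVec]
      ring
    · intro j hj
      rw [Finset.mem_range] at hj
      simp only [kerVec, if_pos hj]
      split_ifs <;> simp
  have hdeg : ∀ β, (part hM β).degree = ∑ e : Edge M, (kerVec M β e.1 e.2).toNat := by
    intro β
    have : Fintype (graph M).edgeSet := Fintype.ofEquiv _ (edgeEquiv hM)
    rw [Finsupp.degree_eq_sum, ← Equiv.sum_comp (edgeEquiv hM)]
    simp only [part_apply]
  have h1 := degree_eq_of_vertexDeg_eq (vertexDeg_part hM β)
  have h2 : (2 * (part hM β).degree : ℤ) = (part hM β).degree + (part hM (-β)).degree := by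
    rw [← h1]; ring
  rw [h2, hdeg, hdeg]
  push_cast
  rw [← Finset.sum_add_distrib]
  have h3 : ∀ e : Edge M, (((kerVec M β e.1 e.2).toNat : ℤ) + (kerVec M (-β) e.1 e.2).toNat) =
      |kerVec M β e.1 e.2| := by
    intro e
    rw [kerVec_neg]
    rcases abs_cases (kerVec M β e.1 e.2) <;> omega
  rw [Finset.sum_congr rfl fun e _ => h3 e, Fintype.sum_prod_type]
  simp only [hrow, Fin.sum_univ_three]
  ring

theorem part_ne (hM : 0 < M) {β : Fin 3 → ℤ} (hβ : β ≠ 0) : part hM β ≠ part hM (-β) := by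
  obtain ⟨i, hi⟩ := Function.ne_iff.mp hβ
  intro h
  have h1 := DFunLike.congr_fun h (edgeEquiv hM (i, ⟨0, by omega⟩))
  rw [part_apply, part_apply, kerVec_neg] at h1
  simp only [kerVec, Pi.zero_apply] at h1 hi
  rw [if_pos (by omega), if_pos (by omega)] at h1
  omega

theorem mem_vars_binom_part (hM : 0 < M) {β : Fin 3 → ℤ} (hβ : β ≠ 0) (e : Edge M) :
    edgeEquiv hM e ∈ (binom K (part hM β) (part hM (-β))).vars ↔ kerVec M β e.1 e.2 ≠ 0 := by
  classical
  rw [vars_binom (part_ne hM hβ), Finset.mem_union, Finsupp.mem_support_iff,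
    Finsupp.mem_support_iff, part_apply, part_apply, kerVec_neg]
  omega

/-! ### An element of the universal Gröbner basis of large degree -/

theorem eq_part_one_or (hM : 0 < M) {a : (graph M).edgeSet →₀ ℕ}
    (h : vertexDeg (graph M) a = vertexDeg (graph M) (part hM 1)) :
    a = part hM 1 ∨ a = part hM (-1) := by
  obtain ⟨β, hβ⟩ := (vertexDeg_eq_iff hM _ _).mp h.symm
  have hbound : ∀ i, 0 ≤ β i ∧ β i ≤ 1 ∧ 0 ≤ turn β i ∧ turn β i ≤ 1 := by
    intro i
    have h0 := hβ (i, ⟨0, by omega⟩)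
    have h1 := hβ (i, ⟨1, by omega⟩)
    have h2 := hβ (i, ⟨2 * M + 1, by omega⟩)
    have h3 := hβ (i, ⟨2 * M + 2, by omega⟩)
    rw [part_apply] at h0 h1 h2 h3
    have ht : turn 1 i = 1 := by simp [turn]
    simp only [kerVec, ht, Pi.one_apply] at h0 h1 h2 h3
    split_ifs at h0 h1 h2 h3 <;> first | omega | contradiction
  have hcases : β = 0 ∨ β = 1 := by
    have b0 := hbound 0
    have b1 := hbound 1
    have b2 := hbound 2
    simp only [turn, Fin.isValue, Fin.reduceAdd] at b0 b1 b2
    have : (β 0 = 0 ∧ β 1 = 0 ∧ β 2 = 0) ∨ (β 0 = 1 ∧ β 1 = 1 ∧ β 2 = 1) := by omega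
    refine this.imp (fun h => ?_) fun h => ?_ <;> ext i <;> fin_cases i <;> simp [h]
  rcases hcases with rfl | rfl
  · refine Or.inl (ext_edge hM fun e => ?_)
    have h1 := hβ e
    have h2 : kerVec M 0 e.1 e.2 = 0 := by simp [kerVec, turn]
    omega
  · refine Or.inr (ext_edge hM fun e => ?_)
    have h1 := hβ e
    rw [part_apply] at h1 ⊢
    rw [kerVec_neg]
    omega

theorem exists_mem_universalGB (K : Type*) [Field K] (hM : 0 < M) :
    ∃ u v, u ≠ v ∧ binom K u v ∈ UniversalGB (graphToricIdeal K (graph M)) ∧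
      2 * (binom K u v).totalDegree = 3 * (2 * M + 1) + 9 := by
  have hI := isToricFor_graphToricIdeal (K := K) (graph M)
  have hdeg := vertexDeg_part hM 1
  have hne := part_ne hM (β := 1) one_ne_zero
  have hdisj := part_eq_zero_or hM 1
  have hfib := fun a => eq_part_one_or hM (a := a)
  have htot : 2 * (part hM 1).degree = 3 * (2 * M + 1) + 9 := by
    have h1 := two_mul_degree_part hM 1
    simp [turn] at h1
    omega
  have hdeg' := degree_eq_of_vertexDeg_eq hdeg
  have : Finite (graph M).edgeSet := Finite.of_equiv _ (edgeEquiv hM)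
  obtain ⟨m⟩ := nonempty_monomialOrder (graph M).edgeSet
  rcases lt_or_gt_of_ne (m.toSyn.injective.ne hne) with h | h
  · refine ⟨_, _, hne.symm, hI.mem_universalGB m hdeg.symm (fun a ha => ?_) (fun i => ?_) h, ?_⟩
    · exact (hfib a (ha.trans hdeg.symm)).symm
    · exact (hdisj i).symm
    · rw [totalDegree_binom hne.symm, ← hdeg', max_self, htot]
  · refine ⟨_, _, hne, hI.mem_universalGB m hdeg hfib hdisj h, ?_⟩
    rw [totalDegree_binom hne, ← hdeg', max_self, htot]

/-! ### The circuits -/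

theorem cases_of_support_minimal (hM : 0 < M) {β : Fin 3 → ℤ}
    (hmin : ∀ γ : Fin 3 → ℤ, γ ≠ 0 →
      (∀ e : Edge M, kerVec M γ e.1 e.2 ≠ 0 → kerVec M β e.1 e.2 ≠ 0) →
      ∀ e : Edge M, kerVec M β e.1 e.2 ≠ 0 → kerVec M γ e.1 e.2 ≠ 0) :
    (∃ k, β k = 0) ∧ ∃ n : ℕ, ∀ i, β i = 0 ∨ |β i| = n := by
  have key : ∀ γ : Fin 3 → ℤ, γ ≠ 0 → (∀ i, γ i ≠ 0 → β i ≠ 0) →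
      (∀ i, turn γ i ≠ 0 → turn β i ≠ 0) →
      (∀ i, β i ≠ 0 → γ i ≠ 0) ∧ ∀ i, turn β i ≠ 0 → turn γ i ≠ 0 := by
    intro γ hγ h1 h2
    have h := hmin γ hγ fun e => by
      have := h1 e.1
      have := h2 e.1
      simp only [kerVec]
      split_ifs <;> omega
    refine ⟨fun i => ?_, fun i => ?_⟩
    · simpa [kerVec] using h (i, ⟨0, by omega⟩)
    · simpa [kerVec] using h (i, ⟨2 * M + 1, by omega⟩)
  have k0 := key ![1, 1, 0] (by simp)
  have k1 := key ![0, 1, 1] (by simp)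
  have k2 := key ![1, 0, 1] (by simp)
  simp [Fin.forall_fin_succ, turn] at k0 k1 k2
  have hk : (β 0 = 0 ∨ β 1 = 0 ∨ β 2 = 0) := by
    omega
  refine ⟨by simpa [Fin.exists_fin_succ] using hk, ?_⟩
  refine ⟨max (β 0).natAbs (max (β 1).natAbs (β 2).natAbs), ?_⟩
  simp only [Fin.forall_fin_succ, Int.abs_eq_natAbs, Fin.succ_zero_eq_one, Fin.succ_one_eq_two,
    IsEmpty.forall_iff, and_true]
  omega

theorem totalDegree_le_of_isCircuitBinomial (hM : 0 < M)
    {g : MvPolynomial (graph M).edgeSet K}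
    (hg : IsCircuitBinomial (graphToricIdeal K (graph M)) g) :
    2 * g.totalDegree ≤ 2 * (2 * M + 1) + 12 := by
  have hI := isToricFor_graphToricIdeal (K := K) (graph M)
  obtain ⟨⟨a, b, hab, rfl⟩, hmem, hirr, hmin⟩ := hg
  have hdeg := hI.deg_eq hmem
  obtain ⟨β, hβ⟩ := (vertexDeg_eq_iff hM _ _).mp hdeg
  obtain ⟨rfl, rfl⟩ := eq_part hM (hI.disjoint_of_irreducible hirr hdeg) hβ
  have hβ0 : β ≠ 0 := by
    rintro rfl
    simp at hab
  obtain ⟨⟨k, hk⟩, n, hn⟩ := cases_of_support_minimal hM (β := β) fun γ hγ h e he => by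
    have h1 := hmin _ ⟨_, _, part_ne hM hγ, rfl⟩ (hI.binom_mem (vertexDeg_part hM γ))
        fun e' he' => by
      obtain ⟨e', rfl⟩ := (edgeEquiv hM).surjective e'
      rw [mem_vars_binom_part hM hγ] at he'
      rw [mem_vars_binom_part hM hβ0]
      exact h e' he'
    rwa [← mem_vars_binom_part (K := K) hM hγ, h1, mem_vars_binom_part hM hβ0]
  have hsign : β = (n : ℤ) • fun i => (β i).sign := by
    ext i
    rcases hn i with h | h
    · simp [h]
    · rw [Pi.smul_apply, smul_eq_mul, ← h, mul_comm, Int.sign_mul_abs]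
  have hn1 : n ≤ 1 := by
    set s : Fin 3 → ℤ := fun i => (β i).sign
    have ha : part hM β = n • part hM s := by rw [hsign, part_smul]
    have hb : part hM (-β) = n • part hM (-s) := by rw [hsign, ← smul_neg, part_smul]
    have hs := degree_eq_of_vertexDeg_eq (vertexDeg_part hM s)
    rw [ha, hb] at hirr hab
    refine hI.le_one_of_irreducible (fun h => hab ?_) (fun h => hab ?_) (vertexDeg_part hM s) hirr
    · rw [h, map_zero, eq_comm, Finsupp.degree_eq_zero_iff] at hs
      rw [h, hs]
    · rw [h, map_zero, Finsupp.degree_eq_zero_iff] at hs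
      rw [h, hs]
  have hle : ∀ i, |β i| ≤ 1 := fun i => by
    rcases hn i with h | h
    · simp [h]
    · omega
  rw [totalDegree_binom hab, ← degree_eq_of_vertexDeg_eq hdeg, max_self]
  have h1 := two_mul_degree_part hM β
  have h2 : |β 0| + |β 1| + |β 2| ≤ 2 := by
    have := hle 0
    have := hle 1
    have := hle 2
    fin_cases k <;> simp at hk <;> rw [hk] <;> simp <;> omega
  have h3 : |turn β 0| + |turn β 1| + |turn β 2| ≤ 4 := by
    have := hle 0
    have := hle 1
    have := hle 2
    simp only [turn, Fin.isValue, Fin.reduceAdd, Int.abs_eq_natAbs] at *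
    fin_cases k <;> simp only [Fin.zero_eta, Fin.mk_one, Fin.reduceFinMk] at hk <;> omega
  nlinarith

end HangingCycles

/-- For every `N > 0` there is a finite simple connected graph `G` such that
the universal Gröbner basis of `I_G` contains a binomial whose degree exceeds the degree of
every circuit of `I_G` by at least `N`. -/
theorem exists_graph_universalGB_degree_gap (K : Type*) [Field K] (N : ℕ) (hN : 0 < N) :
    ∃ (V : Type) (_ : Fintype V) (G : SimpleGraph V), G.Connected ∧
      ∃ f, f ∈ UniversalGB (graphToricIdeal K G) ∧
        (∃ u v : G.edgeSet →₀ ℕ, u ≠ v ∧ f = binom K u v) ∧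
        ∀ g, IsCircuitBinomial (graphToricIdeal K G) g →
          g.totalDegree + N ≤ f.totalDegree := by
  have hM : 0 < N + 1 := Nat.succ_pos N
  obtain ⟨u, v, huv, hmem, hdeg⟩ := HangingCycles.exists_mem_universalGB K hM
  refine ⟨HangingCycles.Vert (N + 1), inferInstance, HangingCycles.graph (N + 1),
    HangingCycles.connected_graph hM, binom K u v, hmem, ⟨u, v, huv, rfl⟩, fun g hg => ?_⟩
  have hcirc := HangingCycles.totalDegree_le_of_isCircuitBinomial hM hg
  omega

end
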